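/- If (M, a, s) is a solution with M ≡ 0 (mod 72), then s ≡ 0 (mod 6); and if (M, a, s) is a solution with M ≡ 24 (mod 72), then s ≡ 2 (mod 6) or s ≡ 4 (mod 6). -/

import Mathlib

theorem six_mul_sum_range_add_sq (M : ℕ) (a : ℤ) :
    6 * ∑ i ∈ Finset.range M, (a + i) ^ 2 =
      6 * M * a ^ 2 + 6 * a * M * (M - 1) + (M - 1) * M * (2 * M - 1) := by
  induction M with
  | zero => simp
  | succ n ih =>
    rw [Finset.sum_range_succ, mul_add, ih]
    push_cast
    ring

theorem solution_M_mod_zero_s_congruences (M a s : ℕ) (hM : 1 ≤ M) (ha : 1 ≤ a) (hs : 1 ≤ s)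
    (hsol : ∑ i ∈ Finset.range M, (a + i) ^ 2 = s ^ 2) :
    (M % 72 = 0 → s % 6 = 0) ∧
    (M % 72 = 24 → s % 6 = 2 ∨ s % 6 = 4) := by
  have h := six_mul_sum_range_add_sq M a
  have hs' : ∑ i ∈ Finset.range M, ((a : ℤ) + i) ^ 2 = (s : ℤ) ^ 2 := by exact_mod_cast hsol
  rw [hs'] at h
  have hsq : s ^ 2 % 6 = (s % 6) ^ 2 % 6 := Nat.pow_mod s 2 6
  have hlt : s % 6 < 6 := Nat.mod_lt _ (by norm_num)
  constructor
  · intro hmod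
    obtain ⟨k, rfl⟩ : ∃ k, M = 72 * k := ⟨M / 72, by omega⟩
    have key : (s : ℤ) ^ 2 = 6 * (12 * k * a ^ 2 + 12 * a * k * (72 * k - 1)
        + 2 * k * (72 * k - 1) * (144 * k - 1)) := by
      push_cast at h
      linarith
    have h6 : s ^ 2 % 6 = 0 := by zify; omega
    rw [h6] at hsq
    interval_cases s % 6 <;> omega
  · intro hmod
    obtain ⟨k, rfl⟩ : ∃ k, M = 72 * k + 24 := ⟨M / 72, by omega⟩
    have key : (s : ℤ) ^ 2 = 6 * ((12 * k + 4) * a ^ 2 + (12 * k + 4) * a * (72 * k + 23)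
        + 2 * k * (72 * k + 23) * (144 * k + 47) + 4 * (1728 * k ^ 2 + 1116 * k + 180)) + 4 := by
      push_cast at h
      linarith
    have h4 : s ^ 2 % 6 = 4 := by zify; omega
    rw [h4] at hsq
    interval_cases s % 6 <;> omega
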